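/- The modal logic Grz.3 is characterized by the class of all finite linear orders: a propositional modal formula is provable in Grz.3 if and only if it is valid in every Kripke frame that is a finite linear order (with accessibility relation ≤). -/

import Mathlib

namespace GrzPaper

/-- Propositional modal formulas, built from variables, falsum, implication and box. -/
inductive Formula : Type
  | var : ℕ → Formula
  | fls : Formula
  | impl : Formula → Formula → Formula
  | box : Formula → Formula
deriving DecidableEq

namespace Formula

def neg (φ : Formula) : Formula := impl φ fls
def tru : Formula := neg fls
def disj (φ ψ : Formula) : Formula := impl (neg φ) ψ
def conj (φ ψ : Formula) : Formula := neg (impl φ (neg ψ))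
def dia (φ : Formula) : Formula := neg (box (neg φ))

/-- Uniform substitution. -/
def subst (σ : ℕ → Formula) : Formula → Formula
  | var n => σ n
  | fls => fls
  | impl a b => impl (subst σ a) (subst σ b)
  | box a => box (subst σ a)

/-- Propositional (Boolean) evaluation, treating variables and boxed formulas as atoms. -/
def evalProp (v : Formula → Bool) : Formula → Bool
  | var n => v (var n)
  | fls => false
  | impl a b => !(evalProp v a) || evalProp v b
  | box a => v (box a)

/-- A propositional tautology: true under every Boolean valuation of the atoms
(variables and boxed subformulas). -/
def Tautology (φ : Formula) : Prop := ∀ v, evalProp v φ = true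

end Formula

open Formula

/-- A normal modal logic: contains all propositional tautologies and all instances of K,
closed under modus ponens, necessitation and uniform substitution. -/
structure IsNormalLogic (L : Set Formula) : Prop where
  taut : ∀ φ, Tautology φ → φ ∈ L
  axK : ∀ φ ψ, impl (box (impl φ ψ)) (impl (box φ) (box ψ)) ∈ L
  mp : ∀ φ ψ, impl φ ψ ∈ L → φ ∈ L → ψ ∈ L
  nec : ∀ φ, φ ∈ L → box φ ∈ L
  subst : ∀ φ σ, φ ∈ L → φ.subst σ ∈ L

/-- The normal modal logic generated by a set of axioms: the smallest normal modal
logic containing them. -/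
def Generated (Ax : Set Formula) : Set Formula :=
  ⋂₀ {L | IsNormalLogic L ∧ Ax ⊆ L}

def pv : Formula := var 0
def qv : Formula := var 1

def axT : Formula := impl (box pv) pv
def axFour : Formula := impl (box pv) (box (box pv))
def axGrz : Formula := impl (box (impl (box (impl pv (box pv))) pv)) pv
def axPoint2 : Formula := impl (dia (box pv)) (box (dia pv))
def axPoint3 : Formula := disj (box (impl (box pv) qv)) (box (impl (box qv) pv))

/-- penultimate(φ) : φ ∧ ◇¬φ ∧ □(¬φ → □¬φ). -/
def penultimate (φ : Formula) : Formula :=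
  conj φ (conj (dia (neg φ)) (box (impl (neg φ) (box (neg φ)))))

/-- contingent(φ) : ◇φ ∧ ◇¬φ. -/
def contingent (φ : Formula) : Formula := conj (dia φ) (dia (neg φ))

/-- The axiom Grz* : contingent(p) → ◇(penultimate(p) ∨ penultimate(¬p)). -/
def axGrzStar : Formula :=
  impl (contingent pv) (dia (disj (penultimate pv) (penultimate (neg pv))))

def Grz : Set Formula := Generated {axGrz}
def GrzStarLogic : Set Formula := Generated {axGrzStar}
def S4GrzStar : Set Formula := Generated {axT, axFour, axGrzStar}
def Grz2 : Set Formula := Generated {axGrz, axPoint2}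
def Grz3 : Set Formula := Generated {axGrz, axPoint3}
def KLogic : Set Formula := Generated ∅

/-- A Kripke model: an accessibility relation together with a valuation. -/
structure KripkeModel (W : Type) where
  rel : W → W → Prop
  val : ℕ → W → Prop

/-- Satisfaction of a modal formula at a world of a Kripke model. -/
def Satisfies {W : Type} (M : KripkeModel W) : W → Formula → Prop
  | w, .var n => M.val n w
  | _, .fls => False
  | w, .impl a b => Satisfies M w a → Satisfies M w b
  | w, .box a => ∀ v, M.rel w v → Satisfies M v a

/-- Validity of a formula on a Kripke frame. -/
def ValidOnFrame (W : Type) (R : W → W → Prop) (φ : Formula) : Prop :=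
  ∀ (val : ℕ → W → Prop) (w : W), Satisfies ⟨R, val⟩ w φ

/-- A model labeling of (M,w₀) for (N,u₀): a substitution σ such that every formula is
true at (M,w₀) iff its σ-instance is true at (N,u₀). -/
def ModelLabeling {W U : Type} (M : KripkeModel W) (w0 : W) (N : KripkeModel U) (u0 : U)
    (σ : ℕ → Formula) : Prop :=
  ∀ φ : Formula, Satisfies M w0 φ ↔ Satisfies N u0 (φ.subst σ)

/-- A frame labeling of the frame (W,R) with initial node w₀ for the pointed model (N,u₀). -/
def FrameLabeling {W U : Type} (R : W → W → Prop) (w0 : W) (N : KripkeModel U) (u0 : U)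
    (Φ : W → Formula) : Prop :=
  Satisfies N u0 (Φ w0) ∧
  (∀ u, N.rel u0 u → ∀ w, Satisfies N u (Φ w) →
    ∀ w', (Satisfies N u (dia (Φ w')) ↔ R w w')) ∧
  (∀ u, N.rel u0 u → ∃! w, Satisfies N u (Φ w))

def bigOr : List Formula → Formula
  | [] => fls
  | φ :: l => disj φ (bigOr l)

def bigAnd : List Formula → Formula
  | [] => tru
  | φ :: l => conj φ (bigAnd l)

open Classical in
/-- The disjunction ⋁ {Φ w : P w}. -/
noncomputable def labelFormula {W : Type} [Fintype W] (Φ : W → Formula) (P : W → Prop) :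
    Formula :=
  bigOr ((Finset.univ.filter P).toList.map Φ)

/-- Θ_A : the formula asserting that the button pattern is exactly A. -/
noncomputable def Theta {n : ℕ} (b : Fin n → Formula) (A : Finset (Fin n)) : Formula :=
  bigAnd ((Finset.univ : Finset (Fin n)).toList.map
    (fun i => if i ∈ A then box (b i) else neg (box (b i))))

/-- b₀,…,b_{n−1} are independent buttons at u₀: none is pushed (necessary) at u₀, and
necessarily, whenever the button pattern is exactly A, every larger pattern is possible. -/
def IndependentButtons {U : Type} (N : KripkeModel U) (u0 : U) {n : ℕ}
    (b : Fin n → Formula) : Prop :=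
  (∀ i, ¬ Satisfies N u0 (box (b i))) ∧
  ∀ A : Finset (Fin n), ∀ u, N.rel u0 u → Satisfies N u (Theta b A) →
    ∀ A' : Finset (Fin n), A ⊆ A' → Satisfies N u (dia (Theta b A'))

/-- r₀,…,r_{n−1} form a ratchet of length n at u₀. -/
def Ratchet {U : Type} (N : KripkeModel U) (u0 : U) {n : ℕ} (r : Fin n → Formula) : Prop :=
  (∀ i : Fin n, (i.val = 0 → Satisfies N u0 (box (r i))) ∧
      (0 < i.val → ¬ Satisfies N u0 (box (r i)))) ∧
  (∀ u, N.rel u0 u → ∀ i j : Fin n, i < j →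
      Satisfies N u (box (r j)) → Satisfies N u (box (r i))) ∧
  (∀ u, N.rel u0 u → ∀ i : Fin n, 0 < i.val →
      (∀ j : Fin n, Satisfies N u (box (r j)) ↔ j < i) →
        ∃ v, N.rel u v ∧ ∀ j : Fin n, Satisfies N v (box (r j)) ↔ j ≤ i)

/-- A (finite) tree order: a partial order with a least element in which the set of
predecessors of every element is linearly ordered. -/
def IsTreeOrder {W : Type} (R : W → W → Prop) : Prop :=
  IsPartialOrder W R ∧ (∃ r, ∀ x, R r x) ∧ ∀ x a b, R a x → R b x → R a b ∨ R b a

/-- A baled tree order: a partial order with a greatest element t whose removal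
leaves a tree. -/
def IsBaledTreeOrder {W : Type} (R : W → W → Prop) : Prop :=
  IsPartialOrder W R ∧ ∃ t : W, (∀ x, R x t) ∧
    (∃ r, r ≠ t ∧ ∀ x, x ≠ t → R r x) ∧
    (∀ x a b, x ≠ t → R a x → R b x → R a b ∨ R b a)

/-- Height of a node: the number of its strict predecessors. -/
noncomputable def heightOf {W : Type} (R : W → W → Prop) (x : W) : ℕ :=
  Nat.card {y : W // R y x ∧ y ≠ x}

/-- y is an immediate successor of x. -/
def ImmSucc {W : Type} (R : W → W → Prop) (x y : W) : Prop :=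
  R x y ∧ x ≠ y ∧ ∀ z, R x z → R z y → z = x ∨ z = y

def IsMaximal {W : Type} (R : W → W → Prop) (x : W) : Prop := ∀ z, R x z → z = x

/-- A regular finite tree: all maximal elements have the same height, and any two
elements of the same height have the same number of immediate successors. -/
def IsRegularTree {W : Type} (R : W → W → Prop) : Prop :=
  IsTreeOrder R ∧
  (∀ x y, IsMaximal R x → IsMaximal R y → heightOf R x = heightOf R y) ∧
  (∀ x y, heightOf R x = heightOf R y →
    Nat.card {z : W // ImmSucc R x z} = Nat.card {z : W // ImmSucc R y z})


/-! ### Soundness -/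

theorem satisfies_subst {W : Type} (R : W → W → Prop) (val : ℕ → W → Prop) (σ : ℕ → Formula)
    (φ : Formula) (w : W) :
    Satisfies ⟨R, val⟩ w (φ.subst σ) ↔
      Satisfies ⟨R, fun n x => Satisfies ⟨R, val⟩ x (σ n)⟩ w φ := by
  induction φ generalizing w with
  | var n => rfl
  | fls => rfl
  | impl a b iha ihb => exact imp_congr (iha w) (ihb w)
  | box a ih => exact forall_congr' fun v => imp_congr Iff.rfl (ih v)

open Classical in
theorem satisfies_iff_evalProp {W : Type} (M : KripkeModel W) (w : W) (φ : Formula) :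
    Satisfies M w φ ↔ evalProp (fun ψ => decide (Satisfies M w ψ)) φ = true := by
  induction φ with
  | var n => simp [evalProp]
  | fls => simp [evalProp, Satisfies]
  | impl a b iha ihb =>
    simp only [Satisfies, evalProp, iha, ihb, Bool.or_eq_true, Bool.not_eq_true']
    rw [← Bool.not_eq_true]
    exact imp_iff_not_or
  | box a _ => simp [evalProp]

theorem isNormalLogic_validOnFrame (W : Type) (R : W → W → Prop) :
    IsNormalLogic {φ | ValidOnFrame W R φ} where
  taut _ hφ _ _ := (satisfies_iff_evalProp _ _ _).2 (hφ _)
  axK _ _ _ _ h h' v hv := h v hv (h' v hv)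
  mp _ _ h h' val w := h val w (h' val w)
  nec _ h _ _ _ _ := h _ _
  subst _ _ h _ w := (satisfies_subst _ _ _ _ _).2 (h _ w)

theorem validOnFrame_axGrz (W : Type) [Finite W] [LinearOrder W] :
    ValidOnFrame W (· ≤ ·) axGrz := by
  intro val w h
  by_contra hw
  obtain ⟨m, ⟨hwm, hm⟩, hmax⟩ := (Set.toFinite {v | w ≤ v ∧ ¬ val 0 v}).exists_maximal
    ⟨w, le_rfl, hw⟩
  refine hm (h m hwm fun x hx hpx y hy => ?_)
  by_contra hpy
  have hym : y ≤ m := hmax ⟨hwm.trans (hx.trans hy), hpy⟩ (le_trans hx hy)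
  have hxy : x = y := le_antisymm hy (hym.trans hx)
  subst hxy
  exact hpy hpx

theorem validOnFrame_axPoint3 (W : Type) [LinearOrder W] :
    ValidOnFrame W (· ≤ ·) axPoint3 := by
  intro val w hn y _ hq
  by_contra hp
  refine hn fun x _ hpx => ?_
  rcases le_total x y with h | h
  · exact (hp (hpx y h)).elim
  · exact hq x h

/-! ### The canonical model -/

section Canonical

variable {L : Set Formula}

/-- A set of formulas containing the logic `L` and closed under modus ponens. -/
structure IsTheory (L T : Set Formula) : Prop where
  subset : L ⊆ T
  mp : ∀ φ ψ, impl φ ψ ∈ T → φ ∈ T → ψ ∈ T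

/-- A complete consistent theory of `L`, that is, a world of the canonical model. -/
structure IsCompleteTheory (L T : Set Formula) : Prop extends IsTheory L T where
  fls_notMem : fls ∉ T
  mem_or_neg_mem : ∀ φ, φ ∈ T ∨ neg φ ∈ T

theorem IsNormalLogic.taut_mem_theory (hL : IsNormalLogic L) {T : Set Formula}
    (hT : IsTheory L T) {φ : Formula} (h : Tautology φ) : φ ∈ T :=
  hT.subset (hL.taut φ h)

theorem tautology_impl_self_left (φ ψ : Formula) : Tautology (impl φ (impl ψ φ)) := by
  intro v
  simp only [evalProp]
  cases evalProp v φ <;> cases evalProp v ψ <;> rfl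

theorem tautology_impl_refl (φ : Formula) : Tautology (impl φ φ) := by
  intro v
  simp only [evalProp]
  cases evalProp v φ <;> rfl

theorem tautology_impl_distrib (φ ψ χ : Formula) :
    Tautology (impl (impl φ (impl ψ χ)) (impl (impl φ ψ) (impl φ χ))) := by
  intro v
  simp only [evalProp]
  cases evalProp v φ <;> cases evalProp v ψ <;> cases evalProp v χ <;> rfl

theorem tautology_cases (φ χ : Formula) :
    Tautology (impl (impl φ χ) (impl (impl (neg φ) χ) χ)) := by
  intro v
  simp only [evalProp, neg]
  cases evalProp v φ <;> cases evalProp v χ <;> rfl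

theorem tautology_exfalso (φ : Formula) : Tautology (impl fls φ) := by
  intro v
  simp [evalProp]

theorem tautology_neg_impl (φ ψ : Formula) : Tautology (impl (neg φ) (impl φ ψ)) := by
  intro v
  simp only [evalProp, neg]
  cases evalProp v φ <;> cases evalProp v ψ <;> rfl

/-- The theory obtained by adding `ψ` to `T`. -/
theorem IsTheory.adjoin (hL : IsNormalLogic L) {T : Set Formula} (hT : IsTheory L T)
    (ψ : Formula) : IsTheory L {θ | impl ψ θ ∈ T} where
  subset θ hθ := hT.mp _ _ (hL.taut_mem_theory hT (tautology_impl_self_left θ ψ)) (hT.subset hθ)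
  mp α β h h' :=
    hT.mp _ _ (hT.mp _ _ (hL.taut_mem_theory hT (tautology_impl_distrib ψ α β)) h) h'

/-- Lindenbaum's lemma. -/
theorem IsTheory.exists_isCompleteTheory (hL : IsNormalLogic L) {T : Set Formula}
    (hT : IsTheory L T) {χ : Formula} (hχ : χ ∉ T) :
    ∃ T', T ⊆ T' ∧ IsCompleteTheory L T' ∧ χ ∉ T' := by
  obtain ⟨M, hTM, ⟨hM, hχM⟩, hmax⟩ :=
    zorn_subset_nonempty {S | IsTheory L S ∧ χ ∉ S}
      (fun c hc hchain ⟨S₀, hS₀⟩ => by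
        refine ⟨⋃₀ c, ⟨⟨?_, ?_⟩, ?_⟩, fun s hs => Set.subset_sUnion_of_mem hs⟩
        · exact (hc hS₀).1.subset.trans (Set.subset_sUnion_of_mem hS₀)
        · rintro φ ψ ⟨A, hA, hA'⟩ ⟨B, hB, hB'⟩
          rcases hchain.total hA hB with h | h
          · exact ⟨B, hB, (hc hB).1.mp _ _ (h hA') hB'⟩
          · exact ⟨A, hA, (hc hA).1.mp _ _ hA' (h hB')⟩
        · rintro ⟨A, hA, hA'⟩
          exact (hc hA).2 hA') T ⟨hT, hχ⟩
  have adjoin_mem : ∀ ψ, ψ ∉ M → impl ψ χ ∈ M := by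
    intro ψ hψ
    by_contra hcon
    have hsub : M ⊆ {θ | impl ψ θ ∈ M} := fun θ hθ =>
      hM.mp _ _ (hL.taut_mem_theory hM (tautology_impl_self_left θ ψ)) hθ
    exact hψ (hmax ⟨hM.adjoin hL ψ, hcon⟩ hsub
      (hL.taut_mem_theory hM (tautology_impl_refl ψ)))
  refine ⟨M, hTM, ⟨hM, fun h => ?_, fun φ => ?_⟩, hχM⟩
  · exact hχM (hM.mp _ _ (hL.taut_mem_theory hM (tautology_exfalso χ)) h)
  · by_contra! hcon
    exact hχM (hM.mp _ _ (hM.mp _ _ (hL.taut_mem_theory hM (tautology_cases φ χ))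
      (adjoin_mem φ hcon.1)) (adjoin_mem _ hcon.2))

theorem IsCompleteTheory.impl_mem_iff (hL : IsNormalLogic L) {T : Set Formula}
    (hT : IsCompleteTheory L T) (φ ψ : Formula) : impl φ ψ ∈ T ↔ (φ ∈ T → ψ ∈ T) := by
  refine ⟨hT.mp _ _, fun h => ?_⟩
  rcases hT.mem_or_neg_mem φ with hφ | hφ
  · exact hT.mp _ _ (hL.taut_mem_theory hT.toIsTheory (tautology_impl_self_left ψ φ)) (h hφ)
  · exact hT.mp _ _ (hL.taut_mem_theory hT.toIsTheory (tautology_neg_impl φ ψ)) hφ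

/-- The canonical model of `L`. -/
def canonicalModel (L : Set Formula) : KripkeModel {T // IsCompleteTheory L T} where
  rel S T := ∀ φ, box φ ∈ S.1 → φ ∈ T.1
  val n T := var n ∈ T.1

theorem satisfies_canonicalModel_iff (hL : IsNormalLogic L) (φ : Formula)
    (T : {T // IsCompleteTheory L T}) : Satisfies (canonicalModel L) T φ ↔ φ ∈ T.1 := by
  induction φ generalizing T with
  | var n => rfl
  | fls => exact ⟨False.elim, T.2.fls_notMem⟩
  | impl a b iha ihb =>
    rw [T.2.impl_mem_iff hL, ← iha, ← ihb]
    rfl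
  | box a ih =>
    refine ⟨fun h => ?_, fun h S hS => (ih S).2 (hS a h)⟩
    by_contra hcon
    have hth : IsTheory L {θ | box θ ∈ T.1} :=
      ⟨fun θ hθ => T.2.subset (hL.nec _ hθ),
        fun α β h₁ h₂ => T.2.mp _ _ (T.2.mp _ _ (T.2.subset (hL.axK α β)) h₁) h₂⟩
    obtain ⟨S, hsub, hS, haS⟩ := hth.exists_isCompleteTheory hL hcon
    exact haS ((ih ⟨S, hS⟩).1 (h ⟨S, hS⟩ hsub))

theorem satisfies_canonicalModel_of_mem (hL : IsNormalLogic L) {φ : Formula} (h : φ ∈ L)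
    (T : {T // IsCompleteTheory L T}) : Satisfies (canonicalModel L) T φ :=
  (satisfies_canonicalModel_iff hL φ T).2 (T.2.subset h)

theorem exists_not_satisfies_canonicalModel (hL : IsNormalLogic L) {φ : Formula} (h : φ ∉ L) :
    ∃ T, ¬ Satisfies (canonicalModel L) T φ := by
  obtain ⟨T, -, hT, hφ⟩ :=
    IsTheory.exists_isCompleteTheory hL (T := L) ⟨subset_rfl, hL.mp⟩ h
  exact ⟨⟨T, hT⟩, fun h' => hφ ((satisfies_canonicalModel_iff hL φ _).1 h')⟩

/-- In the canonical model of a logic containing Grz, a failure of `φ` is followed by a failure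
of `φ` beyond which `φ` is persistent. -/
theorem exists_canonical_persistent (hL : IsNormalLogic L) (hGrz : axGrz ∈ L) (φ : Formula)
    {T : {T // IsCompleteTheory L T}} (hT : ¬ Satisfies (canonicalModel L) T φ) :
    ∃ S, (canonicalModel L).rel T S ∧ ¬ Satisfies (canonicalModel L) S φ ∧
      Satisfies (canonicalModel L) S (box (impl φ (box φ))) := by
  have h := satisfies_canonicalModel_of_mem hL (hL.subst _ (fun _ => φ) hGrz) T
  by_contra! hcon
  exact hT (h fun S hS hbox => by_contra fun hφ => hcon S hS hφ hbox)

theorem canonicalModel_refl (hL : IsNormalLogic L) (hGrz : axGrz ∈ L)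
    (T : {T // IsCompleteTheory L T}) : (canonicalModel L).rel T T := by
  intro φ hφ
  rw [← satisfies_canonicalModel_iff hL] at hφ ⊢
  by_contra hcon
  obtain ⟨S, hS, hS', -⟩ := exists_canonical_persistent hL hGrz φ hcon
  exact hS' (hφ S hS)

theorem canonicalModel_trans (hL : IsNormalLogic L) (hGrz : axGrz ∈ L)
    {S T U : {T // IsCompleteTheory L T}} (hST : (canonicalModel L).rel S T)
    (hTU : (canonicalModel L).rel T U) : (canonicalModel L).rel S U := by
  intro φ hφ
  rw [← satisfies_canonicalModel_iff hL] at hφ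
  refine hTU φ (hST _ ?_)
  rw [← satisfies_canonicalModel_iff hL]
  -- apply Grz to `φ ∧ (□φ → □□φ)`
  set ψ := conj φ (impl (box φ) (box (box φ))) with hψ_def
  have hψ : ∀ V, Satisfies (canonicalModel L) V ψ ↔ Satisfies (canonicalModel L) V φ ∧
      (Satisfies (canonicalModel L) V (box φ) →
        Satisfies (canonicalModel L) V (box (box φ))) := by
    intro V
    simp only [hψ_def, conj, neg, Satisfies]
    tauto
  by_contra hcon
  obtain ⟨V, hV, hVψ, hVbox⟩ := exists_canonical_persistent hL hGrz ψ (T := S)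
    fun h => hcon (((hψ S).1 h).2 hφ)
  refine hVψ ((hψ V).2 ⟨hφ V hV, fun hVφ X hX => ?_⟩)
  by_contra hXφ
  have hX' := hVbox X hX ((hψ X).2 ⟨hVφ X hX, fun h => (hXφ h).elim⟩)
  exact hXφ fun Y hY => ((hψ Y).1 (hX' Y hY)).1

theorem canonicalModel_connected (hL : IsNormalLogic L) (h3 : axPoint3 ∈ L)
    {S T U : {T // IsCompleteTheory L T}} (hST : (canonicalModel L).rel S T)
    (hSU : (canonicalModel L).rel S U) :
    (canonicalModel L).rel T U ∨ (canonicalModel L).rel U T := by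
  by_contra! hcon
  simp only [canonicalModel, not_forall] at hcon
  obtain ⟨⟨φ, hφ, hφ'⟩, ψ, hψ, hψ'⟩ := hcon
  have h := satisfies_canonicalModel_of_mem hL
    (hL.subst _ (fun n => if n = 0 then φ else ψ) h3) S
  rw [← satisfies_canonicalModel_iff hL] at hφ hφ' hψ hψ'
  exact hφ' (h (fun h' => hψ' (h' T hST hφ)) U hSU hψ)

end Canonical

/-! ### Finite linear submodels -/

/-- The list of all `ψ` such that `□ψ` is a subformula. -/
def boxedSubformulas : Formula → List Formula
  | var _ => []
  | fls => []
  | impl a b => boxedSubformulas a ++ boxedSubformulas b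
  | box a => a :: boxedSubformulas a

/-- Truth lemma for the finite linear order given by a list of worlds. -/
theorem satisfies_list_iff {W : Type} (M : KripkeModel W) (l : List W) (B : List Formula)
    (hrel : ∀ i j : Fin l.length, i ≤ j → M.rel (l.get i) (l.get j))
    (hB : ∀ ψ ∈ B, ∀ i : Fin l.length, ¬ Satisfies M (l.get i) (box ψ) →
      ∃ j, i ≤ j ∧ ¬ Satisfies M (l.get j) ψ)
    (φ : Formula) (hφ : boxedSubformulas φ ⊆ B) (i : Fin l.length) :
    Satisfies ⟨(· ≤ ·), fun n j => M.val n (l.get j)⟩ i φ ↔ Satisfies M (l.get i) φ := by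
  induction φ generalizing i with
  | var n => rfl
  | fls => rfl
  | impl a b iha ihb =>
    have h := List.append_subset.1 hφ
    exact imp_congr (iha h.1 i) (ihb h.2 i)
  | box a ih =>
    have h := List.cons_subset.1 hφ
    refine ⟨fun hbox => ?_, fun hbox j hij => (ih h.2 j).2 (hbox _ (hrel i j hij))⟩
    by_contra hcon
    obtain ⟨j, hij, hj⟩ := hB a h.1 i hcon
    exact hj ((ih h.2 j).1 (hbox j hij))

theorem mem_of_valid_finite_linearOrder {L : Set Formula} (hL : IsNormalLogic L)
    (hGrz : axGrz ∈ L) (h3 : axPoint3 ∈ L) {φ : Formula}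
    (hφ : ∀ (W : Type) [Finite W] [LinearOrder W], ValidOnFrame W (· ≤ ·) φ) : φ ∈ L := by
  classical
  by_contra hcon
  obtain ⟨u, hu⟩ := exists_not_satisfies_canonicalModel hL hcon
  let M := canonicalModel L
  have htrans : ∀ {x y z}, M.rel x y → M.rel y z → M.rel x z := canonicalModel_trans hL hGrz
  let r : {v // M.rel u v} → {v // M.rel u v} → Prop := fun v v' => M.rel v.1 v'.1
  have : Std.Total r := ⟨fun v v' => canonicalModel_connected hL h3 v.2 v'.2⟩
  have : IsTrans _ r := ⟨fun _ _ _ => htrans⟩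
  have hwit : ∀ ψ, ∃ y : {v // M.rel u v}, ¬ Satisfies M u (box ψ) →
      ¬ Satisfies M y.1 ψ ∧ Satisfies M y.1 (box (impl ψ (box ψ))) := by
    intro ψ
    by_cases hbox : Satisfies M u (box ψ)
    · exact ⟨⟨u, canonicalModel_refl hL hGrz u⟩, fun h => (h hbox).elim⟩
    · have hbox' : ∃ x, M.rel u x ∧ ¬ Satisfies M x ψ := by
        simpa only [Satisfies, not_forall, exists_prop] using hbox
      obtain ⟨x, hux, hx⟩ := hbox'
      obtain ⟨y, hxy, hy⟩ := exists_canonical_persistent hL hGrz ψ hx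
      exact ⟨⟨y, htrans hux hxy⟩, fun _ => hy⟩
  choose y hy using hwit
  let l := ((⟨u, canonicalModel_refl hL hGrz u⟩ :: (boxedSubformulas φ).map y).insertionSort r)
  have hsorted : l.Pairwise r := List.pairwise_insertionSort r _
  have hmem : ∀ v, v ∈ l ↔ v = ⟨u, canonicalModel_refl hL hGrz u⟩ ∨
      v ∈ (boxedSubformulas φ).map y := fun v => by
    rw [List.mem_insertionSort, List.mem_cons]
  have hrel : ∀ i j : Fin l.length, i ≤ j → r (l.get i) (l.get j) := by
    intro i j hij
    rcases hij.eq_or_lt with rfl | hlt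
    · exact canonicalModel_refl hL hGrz _
    · exact List.pairwise_iff_get.1 hsorted i j hlt
  obtain ⟨k, hk⟩ := List.mem_iff_get.1 ((hmem ⟨u, canonicalModel_refl hL hGrz u⟩).2 (Or.inl rfl))
  let N : KripkeModel {v // M.rel u v} := ⟨r, fun n v => M.val n v.1⟩
  have hN : ∀ ψ v, Satisfies N v ψ ↔ Satisfies M v.1 ψ := by
    intro ψ
    induction ψ with
    | var n => exact fun v => Iff.rfl
    | fls => exact fun v => Iff.rfl
    | impl a b iha ihb => exact fun v => imp_congr (iha v) (ihb v)
    | box a ih =>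
      exact fun v => ⟨fun h x hx => (ih ⟨x, htrans v.2 hx⟩).1 (h ⟨x, htrans v.2 hx⟩ hx),
        fun h x hx => (ih x).2 (h x.1 hx)⟩
  refine hu ?_
  have key := (satisfies_list_iff N l (boxedSubformulas φ) hrel ?_ φ (List.Subset.refl _) k).1
    (hφ (Fin l.length) _ k)
  · rw [hN, hk] at key
    exact key
  intro ψ hψ i hi
  have hui : ¬ Satisfies M u (box ψ) := fun h =>
    hi ((hN _ _).2 fun x hx => h x (htrans (l.get i).2 hx))
  obtain ⟨hyψ, hybox⟩ := hy ψ hui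
  obtain ⟨j, hj⟩ := List.mem_iff_get.1 ((hmem (y ψ)).2 (Or.inr (List.mem_map_of_mem hψ)))
  rcases le_total i j with hij | hji
  · refine ⟨j, hij, ?_⟩
    rwa [hN, hj]
  · refine ⟨i, le_rfl, fun h => hi ?_⟩
    have hyi : M.rel (y ψ).1 (l.get i).1 := hj ▸ hrel j i hji
    exact (hN _ _).2 (hybox _ hyi ((hN _ _).1 h))

/-- Grz.3 is characterized by the class of all finite linear orders. -/
theorem statement19 (φ : Formula) :
    φ ∈ Grz3 ↔ ∀ (W : Type) [Finite W] [LinearOrder W], ValidOnFrame W (· ≤ ·) φ := by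
  constructor
  · intro h W _ _
    refine h {φ | ValidOnFrame W (· ≤ ·) φ} ⟨isNormalLogic_validOnFrame W _, ?_⟩
    rintro _ (rfl | rfl)
    · exact validOnFrame_axGrz W
    · exact validOnFrame_axPoint3 W
  · rintro h L ⟨hL, hAx⟩
    exact mem_of_valid_finite_linearOrder hL (hAx (Or.inl rfl)) (hAx (Or.inr rfl)) h

end GrzPaper
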